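/- arXiv:1404.0145 — 2 statements merged into one kernel-verified Lean document; each statement's English description precedes it below -/
import Mathlib

section
/- Consider n ≥ 2 agents on a time-invariant connected undirected graph 𝒢(𝒱,ℰ) with doubly stochastic weight matrix W = [w_ij], where each initial state μ_i(0) ∈ 𝒰_2(ℝ) is Gaussian 𝒩(p_i(0), P_i(0)) with P_i(0) > 0, and each agent updates by the Wasserstein consensus protocol with p = 2. Then every μ_i(t) is Gaussian 𝒩(p_i(t), P_i(t)), with means and square-root variances evolving linearly: p_i(t+1) = Σ_{j∈𝒩_i} w_ij p_j(t) and P_i(t+1)^{1/2} = Σ_{j∈𝒩_i} w_ij P_j(t)^{1/2}. Moreover, for every i ∈ 𝒱, ℓ_2(μ_i(t), μ*) → 0 exponentially fast as t → ∞, where μ* is the Gaussian 𝒩((1/n)Σ_{j∈𝒱} p_j(0), ((1/n)Σ_{j∈𝒱} P_j(0)^{1/2})²), which is the minimizer over η ∈ 𝒰_2(ℝ) of Σ_{j∈𝒱} (1/n) ℓ_2(η, μ_j(0))². -/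
open MeasureTheory Filter Topology

noncomputable section

/-- The set of couplings (transport plans) between two Borel probability measures on ℝ. -/
def Couplings (μ ν : Measure ℝ) : Set (Measure (ℝ × ℝ)) :=
  {γ | IsProbabilityMeasure γ ∧ γ.map Prod.fst = μ ∧ γ.map Prod.snd = ν}

/-- The `p`-Wasserstein distance `ℓ_p` between measures on ℝ. -/
def Wp (p : ℝ) (μ ν : Measure ℝ) : ℝ :=
  ((⨅ γ ∈ Couplings μ ν,
      ∫⁻ z : ℝ × ℝ, ENNReal.ofReal (|z.1 - z.2| ^ p) ∂γ) ^ (1 / p)).toReal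

/-- Membership in `𝒰_p(ℝ)`: Borel probability measures on ℝ with finite `p`-th moment. -/
def MemUp (p : ℝ) (μ : Measure ℝ) : Prop :=
  IsProbabilityMeasure μ ∧ (∫⁻ x : ℝ, ENNReal.ofReal (|x| ^ p) ∂μ) < ⊤

/-- `η` is a Wasserstein barycenter (a minimizer over `𝒰_p(ℝ)` of the weighted sum of
`p`-th powers of `p`-Wasserstein distances) of the family `μs` with weights `w`. -/
def IsBarycenter (p : ℝ) {m : ℕ} (w : Fin m → ℝ) (μs : Fin m → Measure ℝ)
    (η : Measure ℝ) : Prop :=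
  MemUp p η ∧ ∀ χ : Measure ℝ, MemUp p χ →
    ∑ j, w j * Wp p η (μs j) ^ p ≤ ∑ j, w j * Wp p χ (μs j) ^ p

/-- Valid consensus weights: entries in `[0,1]`, positivity pattern symmetric (undirected
network, neighbour `j ∈ 𝒩_i ↔ w i j > 0`), positive diagonal, rows summing to one. -/
def ValidWeights {n : ℕ} (w : Fin n → Fin n → ℝ) : Prop :=
  (∀ i j, w i j ∈ Set.Icc (0 : ℝ) 1) ∧ (∀ i j, 0 < w i j ↔ 0 < w j i) ∧
    (∀ i, 0 < w i i) ∧ (∀ i, ∑ j, w i j = 1)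

/-- One step of the Wasserstein consensus protocol: each agent `i` moves to the unique
minimizer of `η ↦ ∑_j w i j * ℓ_p(η, μs j)^p` over `𝒰_p(ℝ)`. -/
def ConsensusStep (p : ℝ) {n : ℕ} (w : Fin n → Fin n → ℝ) (μs μ' : Fin n → Measure ℝ) : Prop :=
  ∀ i, IsBarycenter p (w i) μs (μ' i) ∧ ∀ χ, IsBarycenter p (w i) μs χ → χ = μ' i

/-- The Wasserstein convex hull of a finite family of measures: the set of all their
Wasserstein barycenters over all weight vectors. -/
def WCoHull (p : ℝ) {m : ℕ} (μs : Fin m → Measure ℝ) : Set (Measure ℝ) :=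
  {η | ∃ w : Fin m → ℝ, (∀ j, 0 ≤ w j) ∧ (∑ j, w j = 1) ∧ IsBarycenter p w μs η}

/-- The Lyapunov-like quantity `ν`: the maximum over pairs of agents of the `p`-th power of
the `p`-Wasserstein distance between their states. -/
def maxWp (p : ℝ) {m : ℕ} (μs : Fin m → Measure ℝ) : ℝ :=
  ⨆ i : Fin m, ⨆ j : Fin m, Wp p (μs i) (μs j) ^ p

/-- The quantile function (generalized inverse cumulative distribution function) `F_μ⁺`. -/
def qf (μ : Measure ℝ) (u : ℝ) : ℝ :=
  sInf {x : ℝ | u ≤ (μ (Set.Iic x)).toReal}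


theorem aux_var {n : ℕ} (w : Fin n → ℝ) (h : ∑ j, w j = 1) (x : Fin n → ℝ) :
    ∑ j, w j * (x j - ∑ k, w k * x k) ^ 2 = ∑ j, w j * x j ^ 2 - (∑ k, w k * x k) ^ 2 := by
  set m := ∑ k, w k * x k with hm
  have : ∀ j, w j * (x j - m) ^ 2 = w j * x j ^ 2 - 2 * m * (w j * x j) + m ^ 2 * w j := by
    intro j; ring
  simp_rw [this, Finset.sum_add_distrib, Finset.sum_sub_distrib, ← Finset.mul_sum, ← hm, h]
  ring

theorem aux_total {n : ℕ} (w : Fin n → Fin n → ℝ)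
    (hrow : ∀ i, ∑ j, w i j = 1) (hcol : ∀ j, ∑ i, w i j = 1) (x : Fin n → ℝ) :
    ∑ i, ∑ j, w i j * (x j - ∑ k, w i k * x k) ^ 2
      = ∑ j, x j ^ 2 - ∑ i, (∑ k, w i k * x k) ^ 2 := by
  simp_rw [fun i => aux_var (w i) (hrow i) x, Finset.sum_sub_distrib]
  congr 1
  rw [Finset.sum_comm]
  simp_rw [← Finset.sum_mul, hcol, one_mul]

theorem aux_strict {n : ℕ} (w : Fin n → Fin n → ℝ)
    (hw0 : ∀ i j, 0 ≤ w i j) (hdiag : ∀ i, 0 < w i i)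
    (hrow : ∀ i, ∑ j, w i j = 1) (hcol : ∀ j, ∑ i, w i j = 1)
    (hconn : (SimpleGraph.fromRel fun i j : Fin n => 0 < w i j).Connected)
    (x : Fin n → ℝ) (hx : ∑ i, x i = 0) (hx1 : ∑ i, x i ^ 2 = 1) :
    ∑ i, (∑ k, w i k * x k) ^ 2 < 1 := by
  by_contra! hcon
  have ht := aux_total w hrow hcol x
  have hnn : ∀ i j, 0 ≤ w i j * (x j - ∑ k, w i k * x k) ^ 2 := fun i j =>
    mul_nonneg (hw0 i j) (sq_nonneg _)
  have hz : ∑ i, ∑ j, w i j * (x j - ∑ k, w i k * x k) ^ 2 = 0 :=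
    le_antisymm (by linarith) (Finset.sum_nonneg fun i _ => Finset.sum_nonneg fun j _ => hnn i j)
  have hz' : ∀ i j, w i j * (x j - ∑ k, w i k * x k) ^ 2 = 0 := by
    intro i j
    have h1 := (Finset.sum_eq_zero_iff_of_nonneg
      (fun i _ => Finset.sum_nonneg fun j _ => hnn i j)).1 hz i (Finset.mem_univ _)
    exact (Finset.sum_eq_zero_iff_of_nonneg (fun j _ => hnn i j)).1 h1 j (Finset.mem_univ _)
  have he : ∀ i j, 0 < w i j → x j = ∑ k, w i k * x k := by
    intro i j hij
    rcases mul_eq_zero.1 (hz' i j) with h | h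
    · exact absurd h hij.ne'
    · exact sub_eq_zero.1 (pow_eq_zero_iff (two_ne_zero) |>.1 h)
  have he2 : ∀ i j, 0 < w i j → x i = x j := fun i j hij =>
    (he i i (hdiag i)).trans (he i j hij).symm
  have hc : ∀ i j, x i = x j := by
    intro i j
    obtain ⟨p⟩ := hconn.preconnected i j
    induction p with
    | nil => rfl
    | cons h _ ih =>
      rw [← ih]
      rw [SimpleGraph.fromRel_adj] at h
      rcases h.2 with h | h
      · exact he2 _ _ h
      · exact (he2 _ _ h).symm
  have hx0 : ∀ i, x i = 0 := by
    intro i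
    have : ∑ j, x j = n * x i := by
      rw [Finset.sum_congr rfl (fun j _ => hc j i)]; simp
    rw [hx] at this
    have hn : (n : ℝ) ≠ 0 := by
      have := i.pos
      positivity
    rcases mul_eq_zero.1 this.symm with h | h
    · exact absurd h hn
    · exact h
  simp [hx0] at hx1

theorem aux_contract {n : ℕ} (w : Fin n → Fin n → ℝ)
    (hw0 : ∀ i j, 0 ≤ w i j) (hdiag : ∀ i, 0 < w i i)
    (hrow : ∀ i, ∑ j, w i j = 1) (hcol : ∀ j, ∑ i, w i j = 1)
    (hconn : (SimpleGraph.fromRel fun i j : Fin n => 0 < w i j).Connected) :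
    ∃ c : ℝ, 0 ≤ c ∧ c < 1 ∧ ∀ x : Fin n → ℝ, ∑ i, x i = 0 →
      ∑ i, (∑ k, w i k * x k) ^ 2 ≤ c * ∑ i, x i ^ 2 := by
  set K : Set (Fin n → ℝ) := {x | ∑ i, x i = 0 ∧ ∑ i, x i ^ 2 = 1} with hK
  have hKc : IsCompact K := by
    apply Metric.isCompact_of_isClosed_isBounded
    · apply IsClosed.inter
      · exact isClosed_eq (by fun_prop) continuous_const
      · exact isClosed_eq (by fun_prop) continuous_const
    · apply (Metric.isBounded_closedBall (x := (0 : Fin n → ℝ)) (r := 1)).subset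
      intro x hx
      rw [mem_closedBall_zero_iff, pi_norm_le_iff_of_nonneg zero_le_one]
      intro i
      rw [Real.norm_eq_abs, ← sq_le_one_iff_abs_le_one, ← hx.2]
      exact Finset.single_le_sum (f := fun i => x i ^ 2) (fun j _ => sq_nonneg _) (Finset.mem_univ i)
  have main : ∃ c : ℝ, 0 ≤ c ∧ c < 1 ∧ ∀ x ∈ K, ∑ i, (∑ k, w i k * x k) ^ 2 ≤ c := by
    rcases K.eq_empty_or_nonempty with h | h
    · exact ⟨0, le_rfl, one_pos, by simp [h]⟩
    · obtain ⟨x0, hx0, hmax⟩ := hKc.exists_isMaxOn h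
        (f := fun x => ∑ i, (∑ k, w i k * x k) ^ 2) (by fun_prop)
      exact ⟨_, Finset.sum_nonneg fun i _ => sq_nonneg _,
        aux_strict w hw0 hdiag hrow hcol hconn x0 hx0.1 hx0.2, fun x hx => hmax hx⟩
  obtain ⟨c, hc0, hc1, hc⟩ := main
  refine ⟨c, hc0, hc1, fun x hx => ?_⟩
  rcases (Finset.sum_nonneg fun i _ => sq_nonneg (x i) : 0 ≤ ∑ i, x i ^ 2).eq_or_lt with h | h
  · have : ∀ i, x i = 0 := fun i => by
      have := (Finset.sum_eq_zero_iff_of_nonneg (fun i _ => sq_nonneg (x i))).1 h.symm i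
        (Finset.mem_univ _)
      simpa using this
    simp [this]
  · set r := ∑ i, x i ^ 2 with hr
    have hs : Real.sqrt r ^ 2 = r := Real.sq_sqrt h.le
    have hsp : 0 < Real.sqrt r := Real.sqrt_pos.2 h
    have := hc (fun i => (Real.sqrt r)⁻¹ * x i) ⟨by rw [← Finset.mul_sum, hx, mul_zero], by
      simp_rw [mul_pow, ← Finset.mul_sum, ← hr, inv_pow, hs]
      exact inv_mul_cancel₀ h.ne'⟩
    have e : ∀ i, ∑ k, w i k * ((Real.sqrt r)⁻¹ * x k) = (Real.sqrt r)⁻¹ * ∑ k, w i k * x k := by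
      intro i; rw [Finset.mul_sum]; exact Finset.sum_congr rfl fun k _ => by ring
    simp_rw [e, mul_pow, ← Finset.mul_sum, inv_pow, hs] at this
    rwa [inv_mul_le_iff₀ h, mul_comm] at this

theorem aux_iter {n : ℕ} (hn : 0 < n) (w : Fin n → Fin n → ℝ)
    (hrow : ∀ i, ∑ j, w i j = 1) (hcol : ∀ j, ∑ i, w i j = 1) (c : ℝ) (hc0 : 0 ≤ c)
    (hc : ∀ x : Fin n → ℝ, ∑ i, x i = 0 →
      ∑ i, (∑ k, w i k * x k) ^ 2 ≤ c * ∑ i, x i ^ 2)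
    (x : ℕ → Fin n → ℝ) (hx : ∀ t i, x (t + 1) i = ∑ j, w i j * x t j) (t : ℕ) :
    ∑ i, (x t i - (n : ℝ)⁻¹ * ∑ j, x 0 j) ^ 2
      ≤ c ^ t * ∑ i, (x 0 i - (n : ℝ)⁻¹ * ∑ j, x 0 j) ^ 2 := by
  set a := (n : ℝ)⁻¹ * ∑ j, x 0 j with ha
  have hna : (n : ℝ) * a = ∑ j, x 0 j := by
    rw [ha, mul_inv_cancel_left₀ (by positivity)]
  have hsum : ∀ t, ∑ i, x t i = ∑ i, x 0 i := by
    intro t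
    induction t with
    | zero => rfl
    | succ t ih =>
      simp_rw [hx, ← ih]
      rw [Finset.sum_comm]
      simp_rw [← Finset.sum_mul, hcol, one_mul]
  induction t with
  | zero => simp
  | succ t ih =>
    have h := hc (fun i => x t i - a) (by
      rw [Finset.sum_sub_distrib, hsum]; simp [hna])
    have e : ∀ i, ∑ k, w i k * (x t k - a) = x (t + 1) i - a := by
      intro i
      simp_rw [mul_sub, Finset.sum_sub_distrib, ← Finset.sum_mul, hrow, one_mul, hx]
    simp_rw [e] at h
    calc _ ≤ _ := h
      _ ≤ c * _ := mul_le_mul_of_nonneg_left ih hc0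
      _ = _ := by ring

theorem aux_memLp {χ : Measure ℝ} (h : MemUp 2 χ) : MemLp (fun x : ℝ => x) 2 χ := by
  have := h.1
  rw [memLp_two_iff_integrable_sq (by fun_prop)]
  refine ⟨by fun_prop, ?_⟩
  rw [hasFiniteIntegral_iff_ofReal (ae_of_all _ fun x => sq_nonneg x)]
  simpa [Real.rpow_two] using h.2

theorem aux_memUp {χ : Measure ℝ} [IsProbabilityMeasure χ] (h : MemLp (fun x : ℝ => x) 2 χ) :
    MemUp 2 χ := by
  refine ⟨inferInstance, ?_⟩
  rw [memLp_two_iff_integrable_sq (by fun_prop)] at h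
  have := (hasFiniteIntegral_iff_ofReal (ae_of_all _ fun x => sq_nonneg x)).1 h.2
  simpa [Real.rpow_two] using this

theorem aux_gauss_memLp (m : ℝ) (v : NNReal) :
    MemLp (fun x : ℝ => x) 2 (ProbabilityTheory.gaussianReal m v) :=
  ProbabilityTheory.memLp_id_gaussianReal 2

/-- the Gelbrich lower bound for a single coupling -/
theorem aux_lower {χ ν : Measure ℝ} (hχ : MemLp (fun x : ℝ => x) 2 χ)
    (hν : MemLp (fun x : ℝ => x) 2 ν) {γ : Measure (ℝ × ℝ)} (hγ : γ ∈ Couplings χ ν) :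
    ENNReal.ofReal ((∫ x, x ∂χ - ∫ x, x ∂ν) ^ 2 +
      (Real.sqrt (ProbabilityTheory.variance (fun x => x) χ)
        - Real.sqrt (ProbabilityTheory.variance (fun x => x) ν)) ^ 2)
      ≤ ∫⁻ z : ℝ × ℝ, ENNReal.ofReal (|z.1 - z.2| ^ (2 : ℝ)) ∂γ := by
  obtain ⟨hp, h1, h2⟩ := hγ
  have hX : MemLp (Prod.fst : ℝ × ℝ → ℝ) 2 γ := by
    rw [← h1] at hχ
    exact (memLp_map_measure_iff (g := fun x : ℝ => x) (by fun_prop) (by fun_prop)).1 hχ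
  have hY : MemLp (Prod.snd : ℝ × ℝ → ℝ) 2 γ := by
    rw [← h2] at hν
    exact (memLp_map_measure_iff (g := fun x : ℝ => x) (by fun_prop) (by fun_prop)).1 hν
  have eX : ∫ x, x ∂χ = ∫ z, z.1 ∂γ := by
    rw [← h1, integral_map (by fun_prop) (by fun_prop)]
  have eY : ∫ x, x ∂ν = ∫ z, z.2 ∂γ := by
    rw [← h2, integral_map (by fun_prop) (by fun_prop)]
  have vX : ProbabilityTheory.variance (fun x => x) χ = ProbabilityTheory.variance Prod.fst γ := by
    rw [← h1, ProbabilityTheory.variance_map (by fun_prop) (by fun_prop)]; rfl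
  have vY : ProbabilityTheory.variance (fun x => x) ν = ProbabilityTheory.variance Prod.snd γ := by
    rw [← h2, ProbabilityTheory.variance_map (by fun_prop) (by fun_prop)]; rfl
  have hXY : MemLp ((Prod.fst : ℝ × ℝ → ℝ) - Prod.snd) 2 γ := hX.sub hY
  have hL : ∫⁻ z : ℝ × ℝ, ENNReal.ofReal (|z.1 - z.2| ^ (2 : ℝ)) ∂γ
      = ENNReal.ofReal (∫ z : ℝ × ℝ, (z.1 - z.2) ^ 2 ∂γ) := by
    rw [ofReal_integral_eq_lintegral_ofReal]
    · simp [Real.rpow_two]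
    · exact hXY.integrable_sq
    · exact ae_of_all _ fun z => sq_nonneg _
  rw [hL]
  apply ENNReal.ofReal_le_ofReal
  have hvs := ProbabilityTheory.variance_eq_sub hXY
  have hvs' : ProbabilityTheory.variance ((Prod.fst : ℝ × ℝ → ℝ) - Prod.snd) γ
      = ∫ z : ℝ × ℝ, (z.1 - z.2) ^ 2 ∂γ - (∫ z : ℝ × ℝ, z.1 - z.2 ∂γ) ^ 2 := hvs
  rw [integral_sub (hX.integrable (by norm_num)) (hY.integrable (by norm_num)), ← eX, ← eY,
    ProbabilityTheory.variance_sub hX hY] at hvs'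
  have hcs : ProbabilityTheory.covariance Prod.fst Prod.snd γ ≤
      Real.sqrt (ProbabilityTheory.variance Prod.fst γ)
        * Real.sqrt (ProbabilityTheory.variance Prod.snd γ) := by
    have hq : ∀ b : ℝ, 0 ≤ ProbabilityTheory.variance Prod.snd γ * (b * b)
        + (-2 * ProbabilityTheory.covariance Prod.fst Prod.snd γ) * b
        + ProbabilityTheory.variance Prod.fst γ := by
      intro b
      have := ProbabilityTheory.variance_nonneg ((Prod.fst : ℝ × ℝ → ℝ) - b • Prod.snd) γ
      rw [ProbabilityTheory.variance_sub hX (hY.const_smul b), ProbabilityTheory.variance_smul,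
        ProbabilityTheory.covariance_smul_right] at this
      linarith
    have hd := discrim_le_zero hq
    rw [← Real.sqrt_mul (ProbabilityTheory.variance_nonneg _ _)]
    apply Real.le_sqrt_of_sq_le
    unfold discrim at hd
    linarith
  rw [vX, vY]
  have s1 := Real.sq_sqrt (ProbabilityTheory.variance_nonneg Prod.fst γ)
  have s2 := Real.sq_sqrt (ProbabilityTheory.variance_nonneg Prod.snd γ)
  nlinarith

theorem aux_Wp_sq (χ ν : Measure ℝ) : Wp 2 χ ν ^ (2 : ℝ) = (⨅ γ ∈ Couplings χ ν,
      ∫⁻ z : ℝ × ℝ, ENNReal.ofReal (|z.1 - z.2| ^ (2 : ℝ)) ∂γ).toReal := by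
  unfold Wp
  rw [ENNReal.toReal_rpow, ← ENNReal.rpow_mul]
  norm_num

theorem aux_fin {χ ν : Measure ℝ} (hc : MemUp 2 χ) (hv : MemUp 2 ν) : (⨅ γ ∈ Couplings χ ν,
      ∫⁻ z : ℝ × ℝ, ENNReal.ofReal (|z.1 - z.2| ^ (2 : ℝ)) ∂γ) ≠ ⊤ := by
  have := hc.1
  have := hv.1
  have hm : χ.prod ν ∈ Couplings χ ν := by
    refine ⟨inferInstance, ?_, ?_⟩
    · rw [Measure.map_fst_prod]; simp
    · rw [Measure.map_snd_prod]; simp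
  refine ne_top_of_le_ne_top ?_ (iInf₂_le _ hm)
  have hX : MemLp (Prod.fst : ℝ × ℝ → ℝ) 2 (χ.prod ν) := by
    have h := aux_memLp hc
    rw [← hm.2.1] at h
    exact (memLp_map_measure_iff (g := fun x : ℝ => x) (by fun_prop) (by fun_prop)).1 h
  have hY : MemLp (Prod.snd : ℝ × ℝ → ℝ) 2 (χ.prod ν) := by
    have h := aux_memLp hv
    rw [← hm.2.2] at h
    exact (memLp_map_measure_iff (g := fun x : ℝ => x) (by fun_prop) (by fun_prop)).1 h
  have := (hasFiniteIntegral_iff_ofReal (ae_of_all _ fun z => sq_nonneg _)).1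
    (hX.sub hY).integrable_sq.2
  simpa [Real.rpow_two] using this.ne

theorem aux_Wp_lower {χ : Measure ℝ} (hc : MemUp 2 χ) (m : ℝ) (s : NNReal) :
    (∫ x, x ∂χ - m) ^ 2 + (Real.sqrt (ProbabilityTheory.variance (fun x => x) χ) - s) ^ 2
      ≤ Wp 2 χ (ProbabilityTheory.gaussianReal m (s ^ 2)) ^ (2 : ℝ) := by
  rw [aux_Wp_sq]
  have hg := aux_gauss_memLp m (s ^ 2)
  rw [← ENNReal.ofReal_le_iff_le_toReal (aux_fin hc (aux_memUp hg))]
  refine le_iInf₂ fun γ hγ => ?_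
  have := aux_lower (aux_memLp hc) hg hγ
  rw [ProbabilityTheory.integral_id_gaussianReal,
    ProbabilityTheory.variance_fun_id_gaussianReal] at this
  simpa [Real.sqrt_sq] using this

theorem aux_gauss_std (m : ℝ) (s : NNReal) :
    (ProbabilityTheory.gaussianReal 0 1).map (fun x => m + s * x)
      = ProbabilityTheory.gaussianReal m (s ^ 2) := by
  have : (fun x : ℝ => m + s * x) = (fun x => m + x) ∘ (fun x => (s : ℝ) * x) := rfl
  rw [this, ← Measure.map_map (by fun_prop) (by fun_prop),
    ProbabilityTheory.gaussianReal_map_const_mul, ProbabilityTheory.gaussianReal_map_const_add]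
  congr 1
  · simp
  · ext; simp

theorem aux_Wp_upper (m m' : ℝ) (s s' : NNReal) :
    Wp 2 (ProbabilityTheory.gaussianReal m (s ^ 2)) (ProbabilityTheory.gaussianReal m' (s' ^ 2))
      ^ (2 : ℝ) ≤ (m - m') ^ 2 + ((s : ℝ) - s') ^ 2 := by
  rw [aux_Wp_sq]
  apply ENNReal.toReal_le_of_le_ofReal (by positivity)
  set g := ProbabilityTheory.gaussianReal 0 1 with hg
  have hm : g.map (fun x => ((m + s * x, m' + s' * x) : ℝ × ℝ)) ∈
      Couplings (ProbabilityTheory.gaussianReal m (s ^ 2))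
        (ProbabilityTheory.gaussianReal m' (s' ^ 2)) := by
    refine ⟨Measure.isProbabilityMeasure_map (by fun_prop), ?_, ?_⟩
    · rw [Measure.map_map (by fun_prop) (by fun_prop)]; exact aux_gauss_std m s
    · rw [Measure.map_map (by fun_prop) (by fun_prop)]; exact aux_gauss_std m' s'
  refine (iInf₂_le _ hm).trans ?_
  rw [lintegral_map (by fun_prop) (by fun_prop)]
  have hi : Integrable (fun x : ℝ => x) g := (aux_gauss_memLp 0 1).integrable (by norm_num)
  have hi2 : Integrable (fun x : ℝ => x ^ 2) g := (aux_gauss_memLp 0 1).integrable_sq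
  have e1 : ∫ x, x ∂g = 0 := ProbabilityTheory.integral_id_gaussianReal
  have e2 : ∫ x, x ^ 2 ∂g = 1 := by
    have h1 := ProbabilityTheory.variance_eq_sub (aux_gauss_memLp 0 1)
    rw [ProbabilityTheory.variance_fun_id_gaussianReal] at h1
    have h2 : ((1 : NNReal) : ℝ) = ∫ x, x ^ 2 ∂g - (∫ x, x ∂g) ^ 2 := h1
    rw [e1] at h2
    simpa using h2.symm
  have hpt : ∀ x : ℝ, ENNReal.ofReal (|m + s * x - (m' + s' * x)| ^ (2 : ℝ)) =
      ENNReal.ofReal ((m - m') ^ 2 + (2 * (m - m') * (s - s')) * x + ((s : ℝ) - s') ^ 2 * x ^ 2) := by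
    intro x
    rw [Real.rpow_two, sq_abs]; congr 1; ring
  simp_rw [hpt]
  rw [← ofReal_integral_eq_lintegral_ofReal]
  · apply ENNReal.ofReal_le_ofReal
    have hi3 : Integrable (fun x : ℝ => (m - m') ^ 2 + (2 * (m - m') * (s - s')) * x) g :=
      (integrable_const _).add (hi.const_mul _)
    rw [integral_add hi3 (hi2.const_mul _),
      integral_add (integrable_const _) (hi.const_mul _),
      integral_const_mul, integral_const_mul, e1, e2]
    simp
  · exact ((integrable_const _).add (hi.const_mul _)).add (hi2.const_mul _)
  · refine ae_of_all _ fun x => ?_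
    have : (m - m') ^ 2 + (2 * (m - m') * (s - s')) * x + ((s : ℝ) - s') ^ 2 * x ^ 2
      = ((m - m') + (s - s') * x) ^ 2 := by ring
    simp only [this]
    exact sq_nonneg _

theorem aux_min {n : ℕ} (w : Fin n → ℝ) (h : ∑ j, w j = 1) (x : Fin n → ℝ) (a : ℝ) :
    ∑ j, w j * (∑ k, w k * x k - x j) ^ 2 ≤ ∑ j, w j * (a - x j) ^ 2 := by
  have h1 := aux_var w h x
  set m := ∑ k, w k * x k with hm
  have e1 : ∀ j, w j * (m - x j) ^ 2 = w j * (x j - m) ^ 2 := by intro j; ring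
  have e2 : ∀ j, w j * (a - x j) ^ 2 = w j * x j ^ 2 - 2 * a * (w j * x j) + a ^ 2 * w j := by
    intro j; ring
  simp_rw [e1, e2, Finset.sum_add_distrib, Finset.sum_sub_distrib, ← Finset.mul_sum, ← hm, h, h1]
  nlinarith [sq_nonneg (a - m)]

theorem aux_bary {n : ℕ} (w : Fin n → ℝ) (hw : ∀ j, 0 ≤ w j) (h : ∑ j, w j = 1)
    (m : Fin n → ℝ) (s : Fin n → NNReal) (M : ℝ) (S : NNReal)
    (hM : M = ∑ j, w j * m j) (hS : (S : ℝ) = ∑ j, w j * (s j : ℝ)) :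
    IsBarycenter 2 w (fun j => ProbabilityTheory.gaussianReal (m j) (s j ^ 2))
      (ProbabilityTheory.gaussianReal M (S ^ 2)) := by
  refine ⟨aux_memUp (aux_gauss_memLp _ _), fun χ hχ => ?_⟩
  calc _ ≤ ∑ j, w j * ((M - m j) ^ 2 + ((S : ℝ) - s j) ^ 2) :=
        Finset.sum_le_sum fun j _ => mul_le_mul_of_nonneg_left (aux_Wp_upper _ _ _ _) (hw j)
    _ ≤ ∑ j, w j * ((∫ x, x ∂χ - m j) ^ 2
          + (Real.sqrt (ProbabilityTheory.variance (fun x => x) χ) - s j) ^ 2) := by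
        simp_rw [mul_add, Finset.sum_add_distrib]
        rw [hM, hS]
        exact add_le_add (aux_min w h _ _) (aux_min w h (fun j => (s j : ℝ)) _)
    _ ≤ _ := Finset.sum_le_sum fun j _ =>
        mul_le_mul_of_nonneg_left (aux_Wp_lower hχ _ _) (hw j)

/-- square-root variances along the protocol -/
def stdSeq {n : ℕ} (w : Fin n → Fin n → ℝ) (s0 : Fin n → NNReal) : ℕ → Fin n → NNReal
  | 0 => s0
  | t + 1 => fun i => ∑ j, (w i j).toNNReal * stdSeq w s0 t j

/-- means along the protocol -/
def meanSeq {n : ℕ} (w : Fin n → Fin n → ℝ) (p0 : Fin n → ℝ) : ℕ → Fin n → ℝ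
  | 0 => p0
  | t + 1 => fun i => ∑ j, w i j * meanSeq w p0 t j

/-- With Gaussian initial measures, a time-invariant connected undirected
network and a doubly stochastic weight matrix, all iterates of the Wasserstein consensus
protocol (`p = 2`) stay Gaussian, with means and square-root variances evolving by linear
consensus, and converge exponentially fast in `ℓ_2` to the Gaussian
`𝒩((1/n)∑_j p_j(0), ((1/n)∑_j P_j(0)^{1/2})²)`, which is the equal-weight Wasserstein
barycenter of the initial measures. -/
theorem gaussian_consensus_doubly_stochastic
    (n : ℕ) (hn : 2 ≤ n)
    (w : Fin n → Fin n → ℝ)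
    (hw0 : ∀ i j, 0 ≤ w i j)
    (hwsym : ∀ i j, 0 < w i j ↔ 0 < w j i)
    (hdiag : ∀ i, 0 < w i i)
    (hrow : ∀ i, ∑ j, w i j = 1)
    (hcol : ∀ j, ∑ i, w i j = 1)
    (hconn : (SimpleGraph.fromRel fun i j : Fin n => 0 < w i j).Connected)
    (p0 : Fin n → ℝ) (P0 : Fin n → NNReal) (hP0 : ∀ i, 0 < P0 i)
    (μ : ℕ → Fin n → Measure ℝ)
    (h0 : ∀ i, μ 0 i = ProbabilityTheory.gaussianReal (p0 i) (P0 i))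
    (hupdate : ∀ t, ConsensusStep 2 w (μ t) (μ (t + 1))) :
    ∃ (pm : ℕ → Fin n → ℝ) (Pv : ℕ → Fin n → NNReal),
      (∀ i, pm 0 i = p0 i) ∧ (∀ i, Pv 0 i = P0 i) ∧
      (∀ t i, μ t i = ProbabilityTheory.gaussianReal (pm t i) (Pv t i)) ∧
      (∀ t i, pm (t + 1) i = ∑ j, w i j * pm t j) ∧
      (∀ t i, (NNReal.sqrt (Pv (t + 1) i) : ℝ) = ∑ j, w i j * (NNReal.sqrt (Pv t j) : ℝ)) ∧
      IsBarycenter 2 (fun _ => (n : ℝ)⁻¹) (μ 0)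
        (ProbabilityTheory.gaussianReal ((n : ℝ)⁻¹ * ∑ j, p0 j)
          (((n : NNReal)⁻¹ * ∑ j, NNReal.sqrt (P0 j)) ^ 2)) ∧
      ∃ C : ℝ, 0 ≤ C ∧ ∃ lam : ℝ, 0 ≤ lam ∧ lam < 1 ∧
        ∀ t i, Wp 2 (μ t i)
            (ProbabilityTheory.gaussianReal ((n : ℝ)⁻¹ * ∑ j, p0 j)
              (((n : NNReal)⁻¹ * ∑ j, NNReal.sqrt (P0 j)) ^ 2)) ≤ C * lam ^ t := by
  have hs : ∀ t i, (stdSeq w (fun i => NNReal.sqrt (P0 i)) (t + 1) i : ℝ)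
      = ∑ j, w i j * (stdSeq w (fun i => NNReal.sqrt (P0 i)) t j : ℝ) := by
    intro t i
    simp [stdSeq, hw0]
  have hm : ∀ t i, meanSeq w p0 (t + 1) i = ∑ j, w i j * meanSeq w p0 t j := fun t i => rfl
  set sq := stdSeq w (fun i => NNReal.sqrt (P0 i)) with hsq
  set mq := meanSeq w p0 with hmq
  have hs0 : ∀ i, sq 0 i = NNReal.sqrt (P0 i) := fun i => rfl
  have hm0 : ∀ i, mq 0 i = p0 i := fun i => rfl
  have hg : ∀ t, μ t = fun i => ProbabilityTheory.gaussianReal (mq t i) (sq t i ^ 2) := by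
    intro t
    induction t with
    | zero => funext i; rw [h0, hs0, hm0, NNReal.sq_sqrt]
    | succ t ih =>
      funext i
      have hu := (hupdate t i).2
      rw [ih] at hu
      exact (hu _ (aux_bary (w i) (hw0 i) (hrow i) _ _ _ _ (hm t i) (hs t i))).symm
  have hnpos : 0 < n := by omega
  have hn0 : (n : ℝ) ≠ 0 := by positivity
  refine ⟨mq, fun t i => sq t i ^ 2, hm0, fun i => by simp [hs0], fun t i => by rw [hg], hm,
    fun t i => by simpa using hs t i, ?_, ?_⟩
  · rw [hg]
    apply aux_bary
    · intro j; positivity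
    · simp [hn0]
    · simp only [Finset.mul_sum, hm0]
    · simp [Finset.mul_sum, hs0]
  · obtain ⟨c, hc0, hc1, hc⟩ := aux_contract w hw0 hdiag hrow hcol hconn
    have hA := aux_iter hnpos w hrow hcol c hc0 hc mq hm
    have hB := aux_iter hnpos w hrow hcol c hc0 hc (fun t i => (sq t i : ℝ)) hs
    set A := ∑ i, (mq 0 i - (n : ℝ)⁻¹ * ∑ j, mq 0 j) ^ 2 with hAdef
    set B := ∑ i, ((sq 0 i : ℝ) - (n : ℝ)⁻¹ * ∑ j, (sq 0 j : ℝ)) ^ 2 with hBdef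
    have hA0 : 0 ≤ A := Finset.sum_nonneg fun i _ => sq_nonneg _
    have hB0 : 0 ≤ B := Finset.sum_nonneg fun i _ => sq_nonneg _
    refine ⟨Real.sqrt (A + B), Real.sqrt_nonneg _, Real.sqrt c, Real.sqrt_nonneg _,
      by rw [Real.sqrt_lt' one_pos]; simpa using hc1, fun t i => ?_⟩
    have hWn : 0 ≤ Wp 2 (μ t i) (ProbabilityTheory.gaussianReal ((n : ℝ)⁻¹ * ∑ j, p0 j)
        (((n : NNReal)⁻¹ * ∑ j, NNReal.sqrt (P0 j)) ^ 2)) := ENNReal.toReal_nonneg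
    refine (pow_le_pow_iff_left₀ hWn (by positivity) two_ne_zero).1 ?_
    rw [mul_pow √(A + B), Real.sq_sqrt (add_nonneg hA0 hB0), ← pow_mul, mul_comm t 2, pow_mul,
      Real.sq_sqrt hc0, hg, ← Real.rpow_two]
    refine (aux_Wp_upper _ _ _ _).trans ?_
    have h1 := (Finset.single_le_sum (f := fun i => (mq t i - (n : ℝ)⁻¹ * ∑ j, mq 0 j) ^ 2)
      (fun j _ => sq_nonneg _) (Finset.mem_univ i)).trans (hA t)
    have h2 := (Finset.single_le_sum
      (f := fun i => ((sq t i : ℝ) - (n : ℝ)⁻¹ * ∑ j, (sq 0 j : ℝ)) ^ 2)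
      (fun j _ => sq_nonneg _) (Finset.mem_univ i)).trans (hB t)
    simp only [hs0, hm0] at h1 h2
    push_cast at h2 ⊢
    linarith

end
end

section
/- Let μ_1,…,μ_m ∈ 𝒰_2(ℝ) and let w_1,…,w_m ≥ 0 with Σ_j w_j = 1. Then the pushforward measure η = (Σ_j w_j F_{μ_j}^+) # Unif(0,1) of the uniform distribution on (0,1) under the map u ↦ Σ_j w_j F_{μ_j}^+(u) is a minimizer over 𝒰_2(ℝ) of Σ_j w_j ℓ_2(·, μ_j)², and its quantile function satisfies F_η^+(u) = Σ_j w_j F_{μ_j}^+(u) for almost every u ∈ (0,1). -/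
open MeasureTheory Filter Topology

noncomputable section

/-- Lebesgue measure on `(0,1)`. -/
abbrev UU : Measure ℝ := volume.restrict (Set.Ioo (0 : ℝ) 1)

instance UU_prob : IsProbabilityMeasure UU := ⟨by simp [UU]⟩

lemma qf_le_iff (μ : Measure ℝ) [IsProbabilityMeasure μ] {u : ℝ} (hu : u ∈ Set.Ioo (0 : ℝ) 1)
    (x : ℝ) : qf μ u ≤ x ↔ u ≤ (μ (Set.Iic x)).toReal := by
  have hF : ∀ y, (μ (Set.Iic y)).toReal = ProbabilityTheory.cdf μ y := fun y =>
    (ProbabilityTheory.cdf_eq_real μ y).symm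
  unfold qf
  simp only [hF]
  set F := ProbabilityTheory.cdf μ with hFd
  have hbdd : BddBelow {x : ℝ | u ≤ F x} := by
    have h := (ProbabilityTheory.tendsto_cdf_atBot μ).eventually (gt_mem_nhds hu.1)
    obtain ⟨b, hb⟩ := h.exists
    refine ⟨b, fun y hy => ?_⟩
    by_contra! hlt
    have := F.mono hlt.le
    simp only [Set.mem_ofPred_eq] at hy
    linarith
  have hne : {x : ℝ | u ≤ F x}.Nonempty := by
    have h := (ProbabilityTheory.tendsto_cdf_atTop μ).eventually (lt_mem_nhds hu.2)
    obtain ⟨b, hb⟩ := h.exists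
    exact ⟨b, hb.le⟩
  constructor
  · intro h
    have hy : ∀ y, x < y → u ≤ F y := by
      intro y hxy
      obtain ⟨z, hz, hzy⟩ := exists_lt_of_csInf_lt hne (lt_of_le_of_lt h hxy)
      exact le_trans hz (F.mono hzy.le)
    have hc : Tendsto F (𝓝[>] x) (𝓝 (F x)) :=
      (F.right_continuous x).mono_left (nhdsWithin_mono _ Set.Ioi_subset_Ici_self)
    exact ge_of_tendsto hc (eventually_nhdsWithin_of_forall hy)
  · intro h
    exact csInf_le hbdd h

lemma qf_monoOn (μ : Measure ℝ) [IsProbabilityMeasure μ] :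
    MonotoneOn (qf μ) (Set.Ioo (0 : ℝ) 1) := by
  intro u hu v hv huv
  rw [qf_le_iff μ hu]
  exact huv.trans ((qf_le_iff μ hv _).1 le_rfl)

lemma qf_aem (μ : Measure ℝ) [IsProbabilityMeasure μ] : AEMeasurable (qf μ) UU :=
  aemeasurable_restrict_of_monotoneOn measurableSet_Ioo (qf_monoOn μ)

lemma qf_left (μ : Measure ℝ) [IsProbabilityMeasure μ] {u : ℝ} (hu : u ∈ Set.Ioo (0 : ℝ) 1) :
    Tendsto (qf μ) (𝓝[<] u) (𝓝 (qf μ u)) := by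
  rw [tendsto_order]
  constructor
  · intro a ha
    have h1 : (μ (Set.Iic a)).toReal < u := by
      by_contra! h
      exact absurd ((qf_le_iff μ hu a).2 h) (not_le.2 ha)
    have h2 : Set.Ioo (max 0 (μ (Set.Iic a)).toReal) u ∈ 𝓝[<] u :=
      Ioo_mem_nhdsLT (max_lt hu.1 h1)
    filter_upwards [h2] with v hv
    have hv0 := (max_lt_iff.1 hv.1)
    by_contra! h
    have := (qf_le_iff μ ⟨hv0.1, hv.2.trans hu.2⟩ a).1 h
    linarith [hv0.2]
  · intro a ha
    filter_upwards [Ioo_mem_nhdsLT hu.1] with v hv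
    exact lt_of_le_of_lt (qf_monoOn μ ⟨hv.1, hv.2.trans hu.2⟩ hu hv.2.le) ha

lemma UU_Iic {c : ℝ} (h0 : 0 ≤ c) (h1 : c ≤ 1) : UU (Set.Iic c) = ENNReal.ofReal c := by
  rw [Measure.restrict_apply measurableSet_Iic]
  apply le_antisymm
  · calc _ ≤ volume (Set.Ioc 0 c) := measure_mono (fun x hx => ⟨hx.2.1, hx.1⟩)
      _ = _ := by simp
  · calc _ = volume (Set.Ioo 0 c) := by simp
      _ ≤ _ := by
        refine measure_mono (fun x hx => ?_)
        exact ⟨hx.2.le, hx.1, hx.2.trans_le h1⟩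

lemma ae_UU : ∀ᵐ u ∂UU, u ∈ Set.Ioo (0 : ℝ) 1 := ae_restrict_mem measurableSet_Ioo

lemma map_qf (μ : Measure ℝ) [IsProbabilityMeasure μ] : UU.map (qf μ) = μ := by
  have : IsProbabilityMeasure (UU.map (qf μ)) := Measure.isProbabilityMeasure_map (qf_aem μ)
  apply Measure.ext_of_Iic
  intro a
  rw [Measure.map_apply_of_aemeasurable (qf_aem μ) measurableSet_Iic]
  have : UU (qf μ ⁻¹' Set.Iic a) = UU (Set.Iic (μ (Set.Iic a)).toReal) := by
    apply measure_congr
    filter_upwards [ae_UU] with u hu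
    exact propext (qf_le_iff μ hu a)
  rw [this, UU_Iic ENNReal.toReal_nonneg, ENNReal.ofReal_toReal (measure_ne_top _ _)]
  exact ENNReal.toReal_le_of_le_ofReal zero_le_one (by simpa using prob_le_one)

lemma half_cost (γ : Measure (ℝ × ℝ)) [SFinite γ] :
    ∫⁻ z, ENNReal.ofReal (z.2 - z.1) ^ 2 ∂γ =
      ∫⁻ p : ℝ × ℝ, γ {z | z.1 ≤ min p.1 p.2 ∧ max p.1 p.2 < z.2} := by
  let A : Set ((ℝ × ℝ) × (ℝ × ℝ)) :=
    {q | q.1.1 ≤ min q.2.1 q.2.2 ∧ max q.2.1 q.2.2 < q.1.2}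
  have hA : MeasurableSet A := by
    have e1 : MeasurableSet {q : (ℝ × ℝ) × (ℝ × ℝ) | q.1.1 ≤ min q.2.1 q.2.2} :=
      measurableSet_le (by fun_prop) (by fun_prop)
    have e2 : MeasurableSet {q : (ℝ × ℝ) × (ℝ × ℝ) | max q.2.1 q.2.2 < q.1.2} :=
      measurableSet_lt (by fun_prop) (by fun_prop)
    exact e1.inter e2
  have h1 := Measure.prod_apply (μ := γ) (ν := (volume : Measure (ℝ × ℝ))) hA
  have h2 := Measure.prod_apply_symm (μ := γ) (ν := (volume : Measure (ℝ × ℝ))) hA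
  have h3 : ∀ z : ℝ × ℝ, (volume : Measure (ℝ × ℝ)) (Prod.mk z ⁻¹' A)
      = ENNReal.ofReal (z.2 - z.1) ^ 2 := by
    intro z
    have : Prod.mk z ⁻¹' A = Set.Ico z.1 z.2 ×ˢ Set.Ico z.1 z.2 := by
      ext p
      simp only [A, Set.mem_preimage, Set.mem_ofPred_eq, le_min_iff, max_lt_iff, Set.mem_prod,
        Set.mem_Ico]
      tauto
    rw [this, Measure.volume_eq_prod, Measure.prod_prod, Real.volume_Ico, sq]
  simp only [h3] at h1
  rw [← h1, h2]
  rfl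

lemma sq_split (x y : ℝ) : ENNReal.ofReal (|x - y| ^ (2 : ℝ)) =
    ENNReal.ofReal (y - x) ^ 2 + ENNReal.ofReal (x - y) ^ 2 := by
  rw [Real.rpow_two, ENNReal.ofReal_pow (abs_nonneg _)]
  rcases le_total x y with h | h
  · rw [ENNReal.ofReal_of_nonpos (sub_nonpos.2 h), abs_sub_comm, abs_of_nonneg (sub_nonneg.2 h)]
    simp
  · rw [ENNReal.ofReal_of_nonpos (sub_nonpos.2 h), abs_of_nonneg (sub_nonneg.2 h)]
    simp

lemma UU_le_coupling {χ μ : Measure ℝ} [IsProbabilityMeasure χ] [IsProbabilityMeasure μ]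
    {γ : Measure (ℝ × ℝ)} (h1 : γ.map Prod.fst = χ) (h2 : γ.map Prod.snd = μ) (s t : ℝ) :
    UU {u | qf χ u ≤ s ∧ t < qf μ u} ≤ γ {z | z.1 ≤ s ∧ t < z.2} := by
  have hb : UU {u | qf χ u ≤ s ∧ t < qf μ u} ≤ χ (Set.Iic s) - μ (Set.Iic t) := by
    calc UU {u | qf χ u ≤ s ∧ t < qf μ u}
        ≤ UU (Set.Ioc (μ (Set.Iic t)).toReal (χ (Set.Iic s)).toReal) := by
          apply measure_mono_ae
          filter_upwards [ae_UU] with u hu hh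
          refine ⟨?_, (qf_le_iff χ hu s).1 hh.1⟩
          by_contra! h
          exact absurd ((qf_le_iff μ hu t).2 h) (not_le.2 hh.2)
      _ ≤ volume (Set.Ioc (μ (Set.Iic t)).toReal (χ (Set.Iic s)).toReal) :=
          Measure.restrict_apply_le _ _
      _ = _ := by
          rw [Real.volume_Ioc, ENNReal.ofReal_sub _ ENNReal.toReal_nonneg,
            ENNReal.ofReal_toReal (measure_ne_top _ _), ENNReal.ofReal_toReal (measure_ne_top _ _)]
  refine hb.trans ?_
  rw [tsub_le_iff_right, ← h1, ← h2, Measure.map_apply measurable_fst measurableSet_Iic,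
    Measure.map_apply measurable_snd measurableSet_Iic]
  refine le_trans (measure_mono ?_) (measure_union_le _ _)
  intro z hz
  rcases le_or_gt z.2 t with h | h
  · exact Or.inr h
  · exact Or.inl ⟨hz, h⟩

lemma half_le {χ μ : Measure ℝ} [IsProbabilityMeasure χ] [IsProbabilityMeasure μ]
    {γ : Measure (ℝ × ℝ)} [IsProbabilityMeasure γ]
    (h1 : γ.map Prod.fst = χ) (h2 : γ.map Prod.snd = μ) :
    ∫⁻ u, ENNReal.ofReal (qf μ u - qf χ u) ^ 2 ∂UU ≤
      ∫⁻ z, ENNReal.ofReal (z.2 - z.1) ^ 2 ∂γ := by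
  have hm : AEMeasurable (fun u => (qf χ u, qf μ u)) UU := (qf_aem χ).prodMk (qf_aem μ)
  have h3 : ∫⁻ u, ENNReal.ofReal (qf μ u - qf χ u) ^ 2 ∂UU =
      ∫⁻ z, ENNReal.ofReal (z.2 - z.1) ^ 2 ∂(UU.map (fun u => (qf χ u, qf μ u))) := by
    rw [lintegral_map' (by fun_prop) hm]
  rw [h3, half_cost, half_cost]
  apply lintegral_mono
  intro p
  have hS : MeasurableSet {z : ℝ × ℝ | z.1 ≤ min p.1 p.2 ∧ max p.1 p.2 < z.2} := by
    have e1 : MeasurableSet {z : ℝ × ℝ | z.1 ≤ min p.1 p.2} :=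
      measurableSet_le (by fun_prop) (by fun_prop)
    have e2 : MeasurableSet {z : ℝ × ℝ | max p.1 p.2 < z.2} :=
      measurableSet_lt (by fun_prop) (by fun_prop)
    exact e1.inter e2
  simp only
  rw [Measure.map_apply_of_aemeasurable hm hS]
  exact UU_le_coupling h1 h2 _ _

lemma cost_le {χ μ : Measure ℝ} [IsProbabilityMeasure χ] [IsProbabilityMeasure μ]
    {γ : Measure (ℝ × ℝ)} (hγ : γ ∈ Couplings χ μ) :
    ∫⁻ u, ENNReal.ofReal (|qf χ u - qf μ u| ^ (2 : ℝ)) ∂UU ≤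
      ∫⁻ z, ENNReal.ofReal (|z.1 - z.2| ^ (2 : ℝ)) ∂γ := by
  obtain ⟨hp, h1, h2⟩ := hγ
  have ha := qf_aem χ
  have hb := qf_aem μ
  simp only [sq_split]
  rw [lintegral_add_left' (by fun_prop), lintegral_add_left' (by fun_prop)]
  refine add_le_add (half_le h1 h2) ?_
  have : IsProbabilityMeasure (γ.map Prod.swap) :=
    Measure.isProbabilityMeasure_map (by fun_prop)
  have := half_le (χ := μ) (μ := χ) (γ := γ.map Prod.swap)
    (by rw [Measure.map_map (by fun_prop) (by fun_prop)]; exact h2)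
    (by rw [Measure.map_map (by fun_prop) (by fun_prop)]; exact h1)
  rw [lintegral_map (by fun_prop) (by fun_prop)] at this
  exact this

/-- Squared Wasserstein cost, in `[0,∞]`. -/
def WW (μ ν : Measure ℝ) : ENNReal :=
  ⨅ γ ∈ Couplings μ ν, ∫⁻ z : ℝ × ℝ, ENNReal.ofReal (|z.1 - z.2| ^ (2 : ℝ)) ∂γ

lemma Wp_sq (μ ν : Measure ℝ) : Wp 2 μ ν ^ (2 : ℝ) = (WW μ ν).toReal := by
  unfold Wp
  rw [ENNReal.toReal_rpow, ← ENNReal.rpow_mul]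
  norm_num [WW]

lemma WW_lt_top {μ ν : Measure ℝ} (hμ : MemUp 2 μ) (hν : MemUp 2 ν) : WW μ ν < ⊤ := by
  obtain ⟨h1, h2⟩ := hμ
  obtain ⟨h3, h4⟩ := hν
  have hc : μ.prod ν ∈ Couplings μ ν := by
    refine ⟨inferInstance, ?_, ?_⟩
    · simpa using Measure.map_fst_prod (μ := μ) (ν := ν)
    · simpa using Measure.map_snd_prod (μ := μ) (ν := ν)
  refine lt_of_le_of_lt (iInf₂_le _ hc) ?_
  calc ∫⁻ z : ℝ × ℝ, ENNReal.ofReal (|z.1 - z.2| ^ (2 : ℝ)) ∂(μ.prod ν)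
      ≤ ∫⁻ z : ℝ × ℝ, (2 * ENNReal.ofReal (|z.1| ^ (2 : ℝ))
          + 2 * ENNReal.ofReal (|z.2| ^ (2 : ℝ))) ∂(μ.prod ν) := by
        apply lintegral_mono
        intro z
        have e2 : (2 : ENNReal) = ENNReal.ofReal 2 := by simp
        simp only [Real.rpow_two, sq_abs]
        rw [e2, ← ENNReal.ofReal_mul (by norm_num), ← ENNReal.ofReal_mul (by norm_num),
          ← ENNReal.ofReal_add (by positivity) (by positivity)]
        apply ENNReal.ofReal_le_ofReal
        nlinarith [sq_nonneg (z.1 + z.2)]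
    _ = 2 * ∫⁻ z : ℝ × ℝ, ENNReal.ofReal (|z.1| ^ (2 : ℝ)) ∂(μ.prod ν)
          + 2 * ∫⁻ z : ℝ × ℝ, ENNReal.ofReal (|z.2| ^ (2 : ℝ)) ∂(μ.prod ν) := by
        rw [lintegral_add_left (by fun_prop), lintegral_const_mul _ (by fun_prop),
          lintegral_const_mul _ (by fun_prop)]
    _ = 2 * ∫⁻ x : ℝ, ENNReal.ofReal (|x| ^ (2 : ℝ)) ∂μ
          + 2 * ∫⁻ x : ℝ, ENNReal.ofReal (|x| ^ (2 : ℝ)) ∂ν := by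
        have k1 := lintegral_map (μ := μ.prod ν) (f := fun x : ℝ => ENNReal.ofReal (|x| ^ (2 : ℝ)))
          (by fun_prop) measurable_fst
        have k2 := lintegral_map (μ := μ.prod ν) (f := fun x : ℝ => ENNReal.ofReal (|x| ^ (2 : ℝ)))
          (by fun_prop) measurable_snd
        rw [hc.2.1] at k1
        rw [hc.2.2] at k2
        rw [k1, k2]
    _ < ⊤ := ENNReal.add_lt_top.2 ⟨ENNReal.mul_lt_top (by simp) h2, ENNReal.mul_lt_top (by simp) h4⟩

lemma variance_min {m : ℕ} (w q : Fin m → ℝ) (hsum : ∑ j, w j = 1) (a : ℝ) :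
    ∑ j, w j * ((∑ i, w i * q i) - q j) ^ 2 ≤ ∑ j, w j * (a - q j) ^ 2 := by
  set Q := ∑ i, w i * q i with hQ
  have h : ∑ j, w j * (a - q j) ^ 2 - ∑ j, w j * (Q - q j) ^ 2 = (a - Q) ^ 2 := by
    rw [← Finset.sum_sub_distrib]
    have : ∀ j, w j * (a - q j) ^ 2 - w j * (Q - q j) ^ 2 =
        (a ^ 2 - Q ^ 2) * w j - 2 * (a - Q) * (w j * q j) := fun j => by ring
    simp only [this]
    rw [Finset.sum_sub_distrib, ← Finset.mul_sum, ← Finset.mul_sum, hsum, ← hQ]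
    ring
  nlinarith [sq_nonneg (a - Q)]

lemma qf_map_eq {Q : ℝ → ℝ} (hQ : MonotoneOn Q (Set.Ioo (0 : ℝ) 1)) (hm : AEMeasurable Q UU)
    {u : ℝ} (hu : u ∈ Set.Ioo (0 : ℝ) 1) (hl : Tendsto Q (𝓝[<] u) (𝓝 (Q u))) :
    qf (UU.map Q) u = Q u := by
  have : IsProbabilityMeasure (UU.map Q) := Measure.isProbabilityMeasure_map hm
  apply le_antisymm
  · rw [qf_le_iff _ hu, Measure.map_apply_of_aemeasurable hm measurableSet_Iic]
    have : UU (Set.Iic u) ≤ UU (Q ⁻¹' Set.Iic (Q u)) := by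
      apply measure_mono_ae
      filter_upwards [ae_UU] with v hv hvu
      exact hQ hv hu hvu
    rw [UU_Iic hu.1.le hu.2.le] at this
    exact (ENNReal.ofReal_le_iff_le_toReal (measure_ne_top _ _)).1 this
  · by_contra! hlt
    have hev := ((hl.eventually (lt_mem_nhds hlt)).and (Ioo_mem_nhdsLT hu.1))
    obtain ⟨v, hv1, hv2⟩ := hev.exists
    have hvI : v ∈ Set.Ioo (0 : ℝ) 1 := ⟨hv2.1, hv2.2.trans hu.2⟩
    have h1 := (qf_le_iff (UU.map Q) hu _).1 le_rfl
    rw [Measure.map_apply_of_aemeasurable hm measurableSet_Iic] at h1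
    have h2 : UU (Q ⁻¹' Set.Iic (qf (UU.map Q) u)) ≤ UU (Set.Iic v) := by
      apply measure_mono_ae
      filter_upwards [ae_UU] with x hx hxq
      by_contra hxv
      have := hQ hvI hx (not_le.1 hxv).le
      exact absurd (lt_of_lt_of_le hv1 this) (not_lt.2 hxq)
    rw [UU_Iic hvI.1.le hvI.2.le] at h2
    have h3 := ENNReal.toReal_le_of_le_ofReal hvI.1.le h2
    linarith [hv2.2]

lemma lintegral_sum_weights {m : ℕ} (w : Fin m → ℝ) (f : Fin m → ℝ → ℝ)
    (hf : ∀ j, AEMeasurable (f j) UU) :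
    ∫⁻ u, ∑ j, ENNReal.ofReal (w j) * ENNReal.ofReal (|f j u| ^ (2 : ℝ)) ∂UU =
      ∑ j, ENNReal.ofReal (w j) * ∫⁻ u, ENNReal.ofReal (|f j u| ^ (2 : ℝ)) ∂UU := by
  rw [lintegral_finsetSum' _ (fun j _ => by have := hf j; fun_prop)]
  refine Finset.sum_congr rfl fun j _ => ?_
  rw [lintegral_const_mul'' _ (by have := hf j; fun_prop)]

/-- The pushforward of the uniform measure on `(0,1)` by the weighted
average `u ↦ ∑_j w_j F_{μ_j}⁺(u)` of the quantile functions is a `2`-Wasserstein barycenter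
of `μ_1, …, μ_m` with weights `w`, and its quantile function is a.e. this weighted
average. -/
theorem barycenter_via_quantile_functions
    (m : ℕ) (μs : Fin m → Measure ℝ) (hμs : ∀ j, MemUp 2 (μs j))
    (w : Fin m → ℝ) (hw : ∀ j, 0 ≤ w j) (hsum : ∑ j, w j = 1) :
    IsBarycenter 2 w μs
        ((volume.restrict (Set.Ioo (0 : ℝ) 1)).map fun u => ∑ j, w j * qf (μs j) u) ∧
      ∀ᵐ u ∂(volume.restrict (Set.Ioo (0 : ℝ) 1)),
        qf ((volume.restrict (Set.Ioo (0 : ℝ) 1)).map fun u => ∑ j, w j * qf (μs j) u) u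
          = ∑ j, w j * qf (μs j) u := by
  haveI hP : ∀ j, IsProbabilityMeasure (μs j) := fun j => (hμs j).1
  set Q : ℝ → ℝ := fun u => ∑ j, w j * qf (μs j) u with hQdef
  have hqm : ∀ j, AEMeasurable (qf (μs j)) UU := fun j => qf_aem (μs j)
  have hQm : AEMeasurable Q UU :=
    Finset.aemeasurable_fun_sum _ fun j _ => (hqm j).const_mul (w j)
  have hQmono : MonotoneOn Q (Set.Ioo (0 : ℝ) 1) := fun u hu v hv huv =>
    Finset.sum_le_sum fun j _ => mul_le_mul_of_nonneg_left (qf_monoOn (μs j) hu hv huv) (hw j)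
  have hη : IsProbabilityMeasure (UU.map Q) := Measure.isProbabilityMeasure_map hQm
  have hηmem : MemUp 2 (UU.map Q) := by
    refine ⟨hη, ?_⟩
    rw [lintegral_map' (by fun_prop) hQm]
    calc ∫⁻ u, ENNReal.ofReal (|Q u| ^ (2 : ℝ)) ∂UU
        ≤ ∫⁻ u, ∑ j, ENNReal.ofReal (w j) * ENNReal.ofReal (|qf (μs j) u| ^ (2 : ℝ)) ∂UU := by
          apply lintegral_mono
          intro u
          simp only [Real.rpow_two, sq_abs]
          simp_rw [← ENNReal.ofReal_mul (hw _)]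
          rw [← ENNReal.ofReal_sum_of_nonneg
            (fun j _ => mul_nonneg (hw j) (sq_nonneg (qf (μs j) u)))]
          apply ENNReal.ofReal_le_ofReal
          have h1 : ∑ j, w j * (Q u - qf (μs j) u) ^ 2 =
              ∑ j, w j * qf (μs j) u ^ 2 - Q u ^ 2 := by
            have : ∀ j, w j * (Q u - qf (μs j) u) ^ 2 =
                Q u ^ 2 * w j - 2 * Q u * (w j * qf (μs j) u) + w j * qf (μs j) u ^ 2 :=
              fun j => by ring
            simp only [this]
            rw [Finset.sum_add_distrib, Finset.sum_sub_distrib, ← Finset.mul_sum,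
              ← Finset.mul_sum, hsum]
            change Q u ^ 2 * 1 - 2 * Q u * Q u + _ = _
            ring
          have h2 : 0 ≤ ∑ j, w j * (Q u - qf (μs j) u) ^ 2 :=
            Finset.sum_nonneg fun j _ => mul_nonneg (hw j) (sq_nonneg _)
          linarith
      _ = ∑ j, ENNReal.ofReal (w j) * ∫⁻ x, ENNReal.ofReal (|x| ^ (2 : ℝ)) ∂(μs j) := by
          rw [lintegral_sum_weights w (fun j u => qf (μs j) u) hqm]
          refine Finset.sum_congr rfl fun j _ => ?_
          conv_rhs => rw [← map_qf (μs j)]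
          rw [lintegral_map' (by fun_prop) (hqm j)]
      _ < ⊤ := ENNReal.sum_lt_top.2 fun j _ => ENNReal.mul_lt_top (by simp) (hμs j).2
  refine ⟨⟨hηmem, fun χ hχ => ?_⟩, ?_⟩
  · haveI := hχ.1
    have hχm := qf_aem χ
    simp only [Wp_sq]
    have key : ∑ j, ENNReal.ofReal (w j) * WW (UU.map Q) (μs j) ≤
        ∑ j, ENNReal.ofReal (w j) * WW χ (μs j) := by
      calc ∑ j, ENNReal.ofReal (w j) * WW (UU.map Q) (μs j)
          ≤ ∑ j, ENNReal.ofReal (w j) *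
              ∫⁻ u, ENNReal.ofReal (|Q u - qf (μs j) u| ^ (2 : ℝ)) ∂UU := by
            refine Finset.sum_le_sum fun j _ => mul_le_mul_right ?_ _
            have hpm : AEMeasurable (fun u => (Q u, qf (μs j) u)) UU := hQm.prodMk (hqm j)
            have hc : UU.map (fun u => (Q u, qf (μs j) u)) ∈ Couplings (UU.map Q) (μs j) := by
              refine ⟨Measure.isProbabilityMeasure_map hpm, ?_, ?_⟩
              · rw [AEMeasurable.map_map_of_aemeasurable (by fun_prop) hpm]
                rfl
              · rw [AEMeasurable.map_map_of_aemeasurable (by fun_prop) hpm]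
                exact map_qf (μs j)
            refine (iInf₂_le _ hc).trans ?_
            rw [lintegral_map' (by fun_prop) hpm]
        _ = ∫⁻ u, ∑ j, ENNReal.ofReal (w j) *
              ENNReal.ofReal (|Q u - qf (μs j) u| ^ (2 : ℝ)) ∂UU := by
            exact (lintegral_sum_weights w (fun j u => Q u - qf (μs j) u)
              fun j => hQm.sub (hqm j)).symm
        _ ≤ ∫⁻ u, ∑ j, ENNReal.ofReal (w j) *
              ENNReal.ofReal (|qf χ u - qf (μs j) u| ^ (2 : ℝ)) ∂UU := by
            apply lintegral_mono
            intro u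
            simp only [Real.rpow_two, sq_abs]
            simp_rw [← ENNReal.ofReal_mul (hw _)]
            rw [← ENNReal.ofReal_sum_of_nonneg
                (fun j _ => mul_nonneg (hw j) (sq_nonneg (Q u - qf (μs j) u))),
              ← ENNReal.ofReal_sum_of_nonneg
                (fun j _ => mul_nonneg (hw j) (sq_nonneg (qf χ u - qf (μs j) u)))]
            apply ENNReal.ofReal_le_ofReal
            exact variance_min w (fun j => qf (μs j) u) hsum (qf χ u)
        _ = ∑ j, ENNReal.ofReal (w j) *
              ∫⁻ u, ENNReal.ofReal (|qf χ u - qf (μs j) u| ^ (2 : ℝ)) ∂UU := by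
            exact (lintegral_sum_weights w (fun j u => qf χ u - qf (μs j) u)
              fun j => hχm.sub (hqm j))
        _ ≤ ∑ j, ENNReal.ofReal (w j) * WW χ (μs j) := by
            refine Finset.sum_le_sum fun j _ => mul_le_mul_right ?_ _
            exact le_iInf₂ fun γ hγ => cost_le hγ
    have hfin : ∀ ρ : Measure ℝ, MemUp 2 ρ → ∀ j,
        ENNReal.ofReal (w j) * WW ρ (μs j) ≠ ⊤ := fun ρ hρ j =>
      ENNReal.mul_ne_top (by simp) (WW_lt_top hρ (hμs j)).ne
    have hreal : ∀ ρ : Measure ℝ, MemUp 2 ρ →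
        (∑ j, ENNReal.ofReal (w j) * WW ρ (μs j)).toReal = ∑ j, w j * (WW ρ (μs j)).toReal := by
      intro ρ hρ
      rw [ENNReal.toReal_sum fun j _ => hfin ρ hρ j]
      refine Finset.sum_congr rfl fun j _ => ?_
      rw [ENNReal.toReal_mul, ENNReal.toReal_ofReal (hw j)]
    rw [← hreal _ hηmem, ← hreal _ hχ]
    exact ENNReal.toReal_mono (ENNReal.sum_ne_top.2 fun j _ => hfin χ hχ j) key
  · filter_upwards [ae_UU] with u hu
    exact qf_map_eq hQmono hQm hu
      (tendsto_finsetSum _ fun j _ => (qf_left (μs j) hu).const_mul (w j))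


end
end
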